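/- arXiv:1003.3371 — 2 statements merged into one kernel-verified Lean document; each statement's English description precedes it below -/
import Mathlib

section
/- Suppose S is harmonic. Then the d^μ-parallel sections ψ₁, ψ₂ satisfy, for l = 1, 2, ∂ₓψ_l = −A_y T ψ_l and ∂_yψ_l = A_x T ψ_l on U (the coordinate form of dψ_l = −(*A)Tψ_l, i.e. the connection d + (*A)T is the quaternionic extension of d^μ restricted to the span of ψ₁, ψ₂). -/
/- STATEMENT 10: Suppose S is harmonic. Then the d^μ-parallel sections ψ₁, ψ₂
satisfy, for l = 1, 2, `∂ₓψ_l = −A_y T ψ_l` and `∂_yψ_l = A_x T ψ_l` on U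
(the coordinate form of `dψ_l = −(*A)Tψ_l`). -/

open Matrix Quaternion

noncomputable section

attribute [local instance] Matrix.normedAddCommGroup Matrix.normedSpace

abbrev Hq : Type := ℍ[ℝ]
abbrev M2 : Type := Matrix (Fin 2) (Fin 2) Hq

/-- the standard embedding ℂ → ℍ (with `span_ℝ{1,i} = ℂ ⊂ ℍ`) -/
def cq (z : ℂ) : Hq := ⟨z.re, z.im, 0, 0⟩
/-- the quaternion `i` -/
def qi : Hq := ⟨0, 1, 0, 0⟩

/-- Hopf field component `A_x = ¼(∂_yS + S∂ₓS)` -/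
def Ax (S Sx Sy : ℝ × ℝ → M2) (p : ℝ × ℝ) : M2 := (4 : ℝ)⁻¹ • (Sy p + S p * Sx p)
/-- Hopf field component `A_y = ¼(−∂ₓS + S∂_yS)` -/
def Ay (S Sx Sy : ℝ × ℝ → M2) (p : ℝ × ℝ) : M2 := (4 : ℝ)⁻¹ • (-Sx p + S p * Sy p)
/-- Hopf field component `Q_x = ¼(S∂ₓS − ∂_yS)` -/
def Qx (S Sx Sy : ℝ × ℝ → M2) (p : ℝ × ℝ) : M2 := (4 : ℝ)⁻¹ • (S p * Sx p - Sy p)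
/-- Hopf field component `Q_y = ¼(∂ₓS + S∂_yS)` -/
def Qy (S Sx Sy : ℝ × ℝ → M2) (p : ℝ × ℝ) : M2 := (4 : ℝ)⁻¹ • (Sx p + S p * Sy p)

/-- connection form `ω^λ_x(v) = ½(A_x v − (A_y v)i)(λ−1) + ½(A_x v + (A_y v)i)(λ⁻¹−1)` -/
def omx (S Sx Sy : ℝ × ℝ → M2) (l : ℂ) (p : ℝ × ℝ) (v : Fin 2 → Hq) : Fin 2 → Hq :=
  fun n =>
    ((2 : ℝ)⁻¹ • ((Ax S Sx Sy p *ᵥ v) n - (Ay S Sx Sy p *ᵥ v) n * qi)) * cq (l - 1) +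
    ((2 : ℝ)⁻¹ • ((Ax S Sx Sy p *ᵥ v) n + (Ay S Sx Sy p *ᵥ v) n * qi)) * cq (l⁻¹ - 1)

/-- connection form `ω^λ_y(v) = ½(A_y v + (A_x v)i)(λ−1) + ½(A_y v − (A_x v)i)(λ⁻¹−1)` -/
def omy (S Sx Sy : ℝ × ℝ → M2) (l : ℂ) (p : ℝ × ℝ) (v : Fin 2 → Hq) : Fin 2 → Hq :=
  fun n =>
    ((2 : ℝ)⁻¹ • ((Ay S Sx Sy p *ᵥ v) n + (Ax S Sx Sy p *ᵥ v) n * qi)) * cq (l - 1) +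
    ((2 : ℝ)⁻¹ • ((Ay S Sx Sy p *ᵥ v) n - (Ax S Sx Sy p *ᵥ v) n * qi)) * cq (l⁻¹ - 1)

/-- the matrix `G = (ψ₁, ψ₂)` with columns `ψ₁` and `ψ₂` -/
def Gm (ψ1 ψ2 : Fin 2 → Hq) : M2 := Matrix.of fun i l => ![ψ1, ψ2] l i

/-- `a = G·((μ+μ⁻¹)/2 · E₂)·G⁻¹` -/
def am (μ : ℂ) (G : M2) : M2 :=
  G * Matrix.scalar (Fin 2) (cq ((μ + μ⁻¹) / 2)) * Ring.inverse G
/-- `b = G·((i(μ⁻¹−μ)/2) · E₂)·G⁻¹` -/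
def bm (μ : ℂ) (G : M2) : M2 :=
  G * Matrix.scalar (Fin 2) (cq (Complex.I * (μ⁻¹ - μ) / 2)) * Ring.inverse G
/-- `T = S(a−E₂) + b` -/
def Tm (S : M2) (μ : ℂ) (G : M2) : M2 := S * (am μ G - 1) + bm μ G

/-- `a` as a function on `U`, built from the parallel frame -/
def af (μ : ℂ) (ψ1 ψ2 : ℝ × ℝ → (Fin 2 → Hq)) (p : ℝ × ℝ) : M2 := am μ (Gm (ψ1 p) (ψ2 p))
/-- `b` as a function on `U`, built from the parallel frame -/
def bf (μ : ℂ) (ψ1 ψ2 : ℝ × ℝ → (Fin 2 → Hq)) (p : ℝ × ℝ) : M2 := bm μ (Gm (ψ1 p) (ψ2 p))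
/-- `T = S(a−E₂) + b` as a function on `U` -/
def Tf (S : ℝ × ℝ → M2) (μ : ℂ) (ψ1 ψ2 : ℝ × ℝ → (Fin 2 → Hq)) (p : ℝ × ℝ) : M2 :=
  Tm (S p) μ (Gm (ψ1 p) (ψ2 p))

@[simp] lemma re_cq (z : ℂ) : (cq z).re = z.re := rfl
@[simp] lemma imI_cq (z : ℂ) : (cq z).imI = z.im := rfl
@[simp] lemma imJ_cq (z : ℂ) : (cq z).imJ = 0 := rfl
@[simp] lemma imK_cq (z : ℂ) : (cq z).imK = 0 := rfl

@[simp] lemma re_qi : qi.re = 0 := rfl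
@[simp] lemma imI_qi : qi.imI = 1 := rfl
@[simp] lemma imJ_qi : qi.imJ = 0 := rfl
@[simp] lemma imK_qi : qi.imK = 0 := rfl

/-- A differentiable curve of quaternionic complex structures anticommutes with its derivative. -/
lemma deriv_anticommute {f : ℝ → M2} {f' : M2} {t : ℝ} (hf : HasDerivAt f f' t)
    (h : ∀ᶠ s in nhds t, f s * f s = -1) : f' * f t = -(f t * f') := by
  have entry (i j : Fin 2) : HasDerivAt (fun s => f s i j) (f' i j) t :=
    hasDerivAt_pi.1 (hasDerivAt_pi.1 hf i) j
  rw [← add_eq_zero_iff_eq_neg]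
  ext1 i j
  have hmul : HasDerivAt (fun s => ∑ k, f s i k * f s k j)
      (∑ k, (f' i k * f t k j + f t i k * f' k j)) t :=
    HasDerivAt.fun_sum fun k _ => (entry i k).fun_mul (entry k j)
  have hconst : HasDerivAt (fun s => ∑ k, f s i k * f s k j) 0 t := by
    refine (hasDerivAt_const t ((-1 : M2) i j)).congr_of_eventuallyEq ?_
    filter_upwards [h] with s hs
    rw [← hs, Matrix.mul_apply]
  simpa [Matrix.mul_apply, Finset.sum_add_distrib] using hmul.unique hconst

section HopfField

variable {S Sx Sy : ℝ × ℝ → M2} {p : ℝ × ℝ}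

lemma Ax_mul_complexStructure (h : S p * S p = -1) (hx : Sx p * S p = -(S p * Sx p))
    (hy : Sy p * S p = -(S p * Sy p)) : Ax S Sx Sy p * S p = -Ay S Sx Sy p := by
  have : S p * Sx p * S p = Sx p := by
    rw [mul_assoc, hx, mul_neg, ← mul_assoc, h, neg_one_mul, neg_neg]
  rw [Ax, Ay, smul_mul_assoc, add_mul, hy, this, ← smul_neg]
  congr 1
  abel

lemma Ay_mul_complexStructure (h : S p * S p = -1) (hx : Sx p * S p = -(S p * Sx p))
    (hy : Sy p * S p = -(S p * Sy p)) : Ay S Sx Sy p * S p = Ax S Sx Sy p := by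
  have : S p * Sy p * S p = Sy p := by
    rw [mul_assoc, hy, mul_neg, ← mul_assoc, h, neg_one_mul, neg_neg]
  rw [Ax, Ay, smul_mul_assoc, add_mul, neg_mul, hx, this]
  congr 1
  abel

end HopfField

lemma Gm_mulVec_single (ψ1 ψ2 : Fin 2 → Hq) (l : Fin 2) (q : Hq) :
    Gm ψ1 ψ2 *ᵥ Pi.single l q = fun n => ![ψ1, ψ2] l n * q := by
  ext1 n
  simp [Gm, Matrix.mulVec_single]

lemma conj_scalar_mulVec {ψ1 ψ2 : Fin 2 → Hq} (hG : IsUnit (Gm ψ1 ψ2)) (q : Hq) (l : Fin 2) :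
    (Gm ψ1 ψ2 * Matrix.scalar (Fin 2) q * Ring.inverse (Gm ψ1 ψ2)) *ᵥ ![ψ1, ψ2] l =
      fun n => ![ψ1, ψ2] l n * q := by
  have hcol : ![ψ1, ψ2] l = Gm ψ1 ψ2 *ᵥ Pi.single l 1 := by
    ext1 n
    rw [Gm_mulVec_single]
    exact (mul_one _).symm
  have hscalar : Matrix.scalar (Fin 2) q *ᵥ Pi.single l 1 = Pi.single l q := by
    ext1 n
    rw [Matrix.scalar_apply, Matrix.mulVec_diagonal]
    rcases eq_or_ne n l with rfl | hn <;> simp [*]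
  conv_lhs => rw [hcol]
  rw [Matrix.mulVec_mulVec, mul_assoc, Ring.inverse_mul_cancel _ hG, mul_one,
    ← Matrix.mulVec_mulVec, hscalar, Gm_mulVec_single]

lemma Tm_mulVec (S : M2) (μ : ℂ) {ψ1 ψ2 : Fin 2 → Hq} (hG : IsUnit (Gm ψ1 ψ2)) (l : Fin 2) :
    Tm S μ (Gm ψ1 ψ2) *ᵥ ![ψ1, ψ2] l =
      S *ᵥ (fun n => ![ψ1, ψ2] l n * cq ((μ + μ⁻¹) / 2 - 1)) +
        fun n => ![ψ1, ψ2] l n * cq (Complex.I * (μ⁻¹ - μ) / 2) := by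
  have hcq : cq ((μ + μ⁻¹) / 2 - 1) = cq ((μ + μ⁻¹) / 2) - 1 := by
    apply Quaternion.ext <;> simp
  rw [Tm, am, bm, Matrix.add_mulVec, ← Matrix.mulVec_mulVec, Matrix.sub_mulVec,
    conj_scalar_mulVec hG, conj_scalar_mulVec hG, Matrix.one_mulVec, hcq]
  congr 2
  ext1 n
  simp [mul_sub]

lemma mulVec_mul_right (M : M2) (v : Fin 2 → Hq) (q : Hq) :
    M *ᵥ (fun n => v n * q) = fun n => (M *ᵥ v) n * q := by
  ext1 n
  simp [Matrix.mulVec, dotProduct, add_mul, mul_assoc]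

section ConnectionForm

variable (S Sx Sy : ℝ × ℝ → M2) (μ : ℂ) (p : ℝ × ℝ) (v : Fin 2 → Hq)

lemma omx_apply (n : Fin 2) : omx S Sx Sy μ p v n =
    (Ax S Sx Sy p *ᵥ v) n * cq ((μ + μ⁻¹) / 2 - 1) +
      (Ay S Sx Sy p *ᵥ v) n * cq (Complex.I * (μ⁻¹ - μ) / 2) := by
  simp only [omx]
  generalize (Ax S Sx Sy p *ᵥ v) n = x, (Ay S Sx Sy p *ᵥ v) n = y
  apply Quaternion.ext <;> simp [-Complex.inv_re, -Complex.inv_im] <;> ring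

lemma omy_apply (n : Fin 2) : omy S Sx Sy μ p v n =
    (Ay S Sx Sy p *ᵥ v) n * cq ((μ + μ⁻¹) / 2 - 1) -
      (Ax S Sx Sy p *ᵥ v) n * cq (Complex.I * (μ⁻¹ - μ) / 2) := by
  simp only [omy]
  generalize (Ax S Sx Sy p *ᵥ v) n = x, (Ay S Sx Sy p *ᵥ v) n = y
  apply Quaternion.ext <;> simp [-Complex.inv_re, -Complex.inv_im] <;> ring

end ConnectionForm

section ParallelFrame

variable {S Sx Sy : ℝ × ℝ → M2} {p : ℝ × ℝ} (μ : ℂ) {ψ1 ψ2 : Fin 2 → Hq}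

lemma omx_eq_Ay_Tm (h : Ay S Sx Sy p * S p = Ax S Sx Sy p) (hG : IsUnit (Gm ψ1 ψ2)) (l : Fin 2) :
    omx S Sx Sy μ p (![ψ1, ψ2] l) =
      Ay S Sx Sy p *ᵥ (Tm (S p) μ (Gm ψ1 ψ2) *ᵥ ![ψ1, ψ2] l) := by
  ext1 n
  rw [Tm_mulVec _ _ hG, Matrix.mulVec_add, Matrix.mulVec_mulVec, h, mulVec_mul_right,
    mulVec_mul_right, omx_apply, Pi.add_apply]

lemma neg_omy_eq_Ax_Tm (h : Ax S Sx Sy p * S p = -Ay S Sx Sy p) (hG : IsUnit (Gm ψ1 ψ2))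
    (l : Fin 2) :
    -omy S Sx Sy μ p (![ψ1, ψ2] l) =
      Ax S Sx Sy p *ᵥ (Tm (S p) μ (Gm ψ1 ψ2) *ᵥ ![ψ1, ψ2] l) := by
  ext1 n
  rw [Tm_mulVec _ _ hG, Matrix.mulVec_add, Matrix.mulVec_mulVec, h, mulVec_mul_right,
    mulVec_mul_right, Pi.neg_apply, omy_apply, Pi.add_apply, Matrix.neg_mulVec, Pi.neg_apply,
    neg_mul, neg_sub, sub_eq_neg_add]

end ParallelFrame

theorem stmt10
    (U : Set (ℝ × ℝ)) (hU : IsOpen U)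
    (S Sx Sy : ℝ × ℝ → M2)
    (hSsm : ContDiffOn ℝ (⊤ : ℕ∞) S U)
    (hSx : ∀ p ∈ U, HasDerivAt (fun t => S (t, p.2)) (Sx p) p.1)
    (hSy : ∀ p ∈ U, HasDerivAt (fun t => S (p.1, t)) (Sy p) p.2)
    (hS2 : ∀ p ∈ U, S p * S p = -1)
    -- S is harmonic: ∂ₓA_x + ∂_yA_y = 0 on U
    (Axx Ayy : ℝ × ℝ → M2)
    (hAxx : ∀ p ∈ U, HasDerivAt (fun t => Ax S Sx Sy (t, p.2)) (Axx p) p.1)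
    (hAyy : ∀ p ∈ U, HasDerivAt (fun t => Ay S Sx Sy (p.1, t)) (Ayy p) p.2)
    (hharm : ∀ p ∈ U, Axx p + Ayy p = 0)
    -- fixed spectral parameter μ ∈ ℂ*
    (μ : ℂ) (hμ0 : μ ≠ 0)
    -- two d^μ-parallel sections ψ₁, ψ₂ whose frame G is invertible
    (ψ1 ψ2 : ℝ × ℝ → (Fin 2 → Hq))
    (hψ1sm : ContDiffOn ℝ (⊤ : ℕ∞) ψ1 U) (hψ2sm : ContDiffOn ℝ (⊤ : ℕ∞) ψ2 U)
    (hψ1x : ∀ p ∈ U, HasDerivAt (fun t => ψ1 (t, p.2)) (-(omx S Sx Sy μ p (ψ1 p))) p.1)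
    (hψ1y : ∀ p ∈ U, HasDerivAt (fun t => ψ1 (p.1, t)) (-(omy S Sx Sy μ p (ψ1 p))) p.2)
    (hψ2x : ∀ p ∈ U, HasDerivAt (fun t => ψ2 (t, p.2)) (-(omx S Sx Sy μ p (ψ2 p))) p.1)
    (hψ2y : ∀ p ∈ U, HasDerivAt (fun t => ψ2 (p.1, t)) (-(omy S Sx Sy μ p (ψ2 p))) p.2)
    (hGu : ∀ p ∈ U, IsUnit (Gm (ψ1 p) (ψ2 p))) :
    -- ∂ₓψ_l = −A_y T ψ_l and ∂_yψ_l = A_x T ψ_l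
    ∀ p ∈ U,
      HasDerivAt (fun t => ψ1 (t, p.2))
        (-(Ay S Sx Sy p *ᵥ (Tf S μ ψ1 ψ2 p *ᵥ ψ1 p))) p.1 ∧
      HasDerivAt (fun t => ψ1 (p.1, t))
        (Ax S Sx Sy p *ᵥ (Tf S μ ψ1 ψ2 p *ᵥ ψ1 p)) p.2 ∧
      HasDerivAt (fun t => ψ2 (t, p.2))
        (-(Ay S Sx Sy p *ᵥ (Tf S μ ψ1 ψ2 p *ᵥ ψ2 p))) p.1 ∧
      HasDerivAt (fun t => ψ2 (p.1, t))
        (Ax S Sx Sy p *ᵥ (Tf S μ ψ1 ψ2 p *ᵥ ψ2 p)) p.2 := by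
  intro p hp
  have hUp : U ∈ nhds p := hU.mem_nhds hp
  have hx : Sx p * S p = -(S p * Sx p) := by
    refine deriv_anticommute (hSx p hp) ?_
    have hc : ContinuousAt (fun t : ℝ => (t, p.2)) p.1 := by fun_prop
    filter_upwards [hc hUp] with s hs using hS2 _ hs
  have hy : Sy p * S p = -(S p * Sy p) := by
    refine deriv_anticommute (hSy p hp) ?_
    have hc : ContinuousAt (fun t : ℝ => (p.1, t)) p.2 := by fun_prop
    filter_upwards [hc hUp] with s hs using hS2 _ hs
  have hxT := omx_eq_Ay_Tm μ (Ay_mul_complexStructure (hS2 p hp) hx hy) (hGu p hp)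
  have hyT := neg_omy_eq_Ax_Tm μ (Ax_mul_complexStructure (hS2 p hp) hx hy) (hGu p hp)
  refine ⟨?_, ?_, ?_, ?_⟩
  · exact congrArg Neg.neg (hxT 0) ▸ hψ1x p hp
  · exact hyT 0 ▸ hψ1y p hp
  · exact congrArg Neg.neg (hxT 1) ▸ hψ2x p hp
  · exact hyT 1 ▸ hψ2y p hp
end
end

section
/- Let S ∈ M₂(ℍ) satisfy S² = −E₂, let G ∈ GL(2,ℍ), let μ ∈ ℂ* with μ ≠ 1, and suppose L ⊆ ℍ² is a quaternionic line (a rank-one right ℍ-submodule) with SL ⊆ L. Then the complex structure Ŝ := T⁻¹ S T stabilises the quaternionic line L̂ := T(a−E₂)⁻¹ L, i.e. Ŝ L̂ ⊆ L̂. -/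
/- STATEMENT 14: Let `S ∈ M₂(ℍ)` with `S² = −E₂`, `G ∈ GL(2,ℍ)`, `μ ∈ ℂ*`, `μ ≠ 1`,
and suppose `L ⊆ ℍ²` is a quaternionic line (a rank-one right ℍ-submodule) with
`SL ⊆ L`. Then the complex structure `Ŝ := T⁻¹ S T` stabilises the quaternionic
line `L̂ := T(a−E₂)⁻¹ L`, i.e. `Ŝ L̂ ⊆ L̂`. -/

open Matrix Quaternion

noncomputable section

theorem cq_one : cq 1 = 1 :=
  Quaternion.coeComplex_one

theorem cq_add (z w : ℂ) : cq (z + w) = cq z + cq w :=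
  Quaternion.coeComplex_add z w

theorem cq_mul (z w : ℂ) : cq (z * w) = cq z * cq w :=
  Quaternion.coeComplex_mul z w

/-- The conjugate by `G` of the scalar matrix of a complex number. -/
def conjScalar (G : M2) (z : ℂ) : M2 :=
  G * Matrix.scalar (Fin 2) (cq z) * Ring.inverse G

theorem conjScalar_add (G : M2) (z w : ℂ) :
    conjScalar G (z + w) = conjScalar G z + conjScalar G w := by
  simp only [conjScalar, cq_add, map_add, mul_add, add_mul]

theorem conjScalar_mul {G : M2} (hG : IsUnit G) (z w : ℂ) :
    conjScalar G (z * w) = conjScalar G z * conjScalar G w := by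
  simp only [conjScalar, cq_mul, map_mul, mul_assoc]
  rw [Ring.inverse_mul_cancel_left _ _ hG]

theorem conjScalar_one {G : M2} (hG : IsUnit G) : conjScalar G 1 = 1 := by
  rw [conjScalar, cq_one, map_one, mul_one, Ring.mul_inverse_cancel _ hG]

theorem isUnit_conjScalar {G : M2} (hG : IsUnit G) {z : ℂ} (hz : z ≠ 0) :
    IsUnit (conjScalar G z) := by
  refine isUnit_iff_exists.mpr ⟨conjScalar G z⁻¹, ?_, ?_⟩
  · rw [← conjScalar_mul hG, mul_inv_cancel₀ hz, conjScalar_one hG]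
  · rw [← conjScalar_mul hG, inv_mul_cancel₀ hz, conjScalar_one hG]

theorem am_sub_one {G : M2} (hG : IsUnit G) (μ : ℂ) :
    am μ G - 1 = conjScalar G ((μ + μ⁻¹) / 2 - 1) := by
  have h := conjScalar_add G ((μ + μ⁻¹) / 2 - 1) 1
  rw [sub_add_cancel, conjScalar_one hG] at h
  rw [sub_eq_iff_eq_add, ← h]
  rfl

theorem isUnit_am_sub_one {G : M2} (hG : IsUnit G) {μ : ℂ} (hμ0 : μ ≠ 0) (hμ1 : μ ≠ 1) :
    IsUnit (am μ G - 1) := by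
  rw [am_sub_one hG]
  refine isUnit_conjScalar hG ?_
  have h : (μ + μ⁻¹) / 2 - 1 = (μ - 1) ^ 2 / (2 * μ) := by
    field_simp
    ring
  rw [h]
  exact div_ne_zero (pow_ne_zero _ (sub_ne_zero.mpr hμ1)) (mul_ne_zero two_ne_zero hμ0)

theorem am_mul_bm {G : M2} (hG : IsUnit G) (μ : ℂ) : am μ G * bm μ G = bm μ G * am μ G := by
  change conjScalar G _ * conjScalar G _ = conjScalar G _ * conjScalar G _
  rw [← conjScalar_mul hG, ← conjScalar_mul hG, mul_comm]

theorem am_sq_add_bm_sq {G : M2} (hG : IsUnit G) {μ : ℂ} (hμ0 : μ ≠ 0) :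
    am μ G * am μ G + bm μ G * bm μ G = 1 := by
  change conjScalar G _ * conjScalar G _ + conjScalar G _ * conjScalar G _ = 1
  rw [← conjScalar_mul hG, ← conjScalar_mul hG, ← conjScalar_add, ← conjScalar_one hG]
  congr 1
  field_simp
  rw [Complex.I_sq]
  ring

/-- If `a` and `b` commute, `a² + b² = 1` and `S² = -1`, then `T² (a - 1)⁻¹` commutes with `S`,
where `T = S (a - 1) + b`. -/
theorem commute_sq_mul_inverse {R : Type*} [Ring R] {S a b d : R} (hS : S * S = -1)
    (hab : a * b = b * a) (hsq : a * a + b * b = 1) (hd : (a - 1) * d = 1) :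
    S * ((S * (a - 1) + b) * ((S * (a - 1) + b) * d)) =
      (S * (a - 1) + b) * ((S * (a - 1) + b) * d) * S := by
  have hb : (a - 1) * b = b * (a - 1) := by
    rw [sub_mul, mul_sub, hab, one_mul, mul_one]
  have hbb : b * b = -((a + 1) * (a - 1)) := by
    rw [← sub_eq_iff_eq_add'.mpr hsq.symm]
    noncomm_ring
  have key : (S * (a - 1) + b) * ((S * (a - 1) + b) * d) = S * a * S + S * b + b * S - a := by
    calc (S * (a - 1) + b) * ((S * (a - 1) + b) * d)
        = S * (a - 1) * S * ((a - 1) * d) + S * ((a - 1) * b) * d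
            + b * S * ((a - 1) * d) + b * b * d := by noncomm_ring
      _ = S * (a - 1) * S * ((a - 1) * d) + S * b * ((a - 1) * d)
            + b * S * ((a - 1) * d) - (a + 1) * ((a - 1) * d) := by
          rw [hb, hbb]; noncomm_ring
      _ = S * a * S - S * S + S * b + b * S - a - 1 := by rw [hd]; noncomm_ring
      _ = S * a * S + S * b + b * S - a := by rw [hS]; abel
  rw [key]
  calc S * (S * a * S + S * b + b * S - a)
      = (S * S) * a * S + (S * S) * b + S * b * S - S * a := by noncomm_ring
    _ = S * a * (S * S) + S * b * S + b * (S * S) - a * S := by rw [hS]; noncomm_ring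
    _ = (S * a * S + S * b + b * S - a) * S := by noncomm_ring

theorem stmt14 (S : M2) (hS : S * S = -1) (G : M2) (hG : IsUnit G)
    (μ : ℂ) (hμ0 : μ ≠ 0) (hμ1 : μ ≠ 1)
    -- L is a quaternionic line: a rank-one right ℍ-submodule of ℍ²
    (L : Set (Fin 2 → Hq))
    (hL : ∃ ψ : Fin 2 → Hq, ψ ≠ 0 ∧ L = {v | ∃ q : Hq, v = fun n => ψ n * q})
    -- S stabilises L
    (hSL : ∀ v ∈ L, S *ᵥ v ∈ L) :
    -- Ŝ = T⁻¹ S T stabilises L̂ = T(a−E₂)⁻¹ L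
    ∀ v ∈ (fun w => (Tm S μ G * Ring.inverse (am μ G - 1)) *ᵥ w) '' L,
      (Ring.inverse (Tm S μ G) * S * Tm S μ G) *ᵥ v ∈
        (fun w => (Tm S μ G * Ring.inverse (am μ G - 1)) *ᵥ w) '' L := by
  rintro _ ⟨w, hw, rfl⟩
  by_cases hT : IsUnit (Tm S μ G)
  · refine ⟨S *ᵥ w, hSL w hw, ?_⟩
    have h := commute_sq_mul_inverse hS (am_mul_bm hG μ) (am_sq_add_bm_sq hG hμ0)
      (Ring.mul_inverse_cancel _ (isUnit_am_sub_one hG hμ0 hμ1))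
    rw [← Tm] at h
    simp only [Matrix.mulVec_mulVec]
    congr 1
    rw [mul_assoc (Ring.inverse _ * S), mul_assoc (Ring.inverse _), h,
      mul_assoc (Tm S μ G) (Tm S μ G * _) S, Ring.inverse_mul_cancel_left _ _ hT]
  · obtain ⟨ψ, -, rfl⟩ := hL
    refine ⟨0, ⟨0, by ext1; simp⟩, ?_⟩
    simp [Ring.inverse_non_unit _ hT]
end
end
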